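/- arXiv:2309.17092 — 2 statements merged into one kernel-verified Lean document; each statement's English description precedes it below -/
import Mathlib

section
/- Let X be a complex m×n matrix, L a complex k×m matrix and R a complex k×n matrix such that X = L*R. Then there exist a complex k×m matrix L₁ with ‖L₁‖_c ≤ ‖L‖_c, ‖L₁‖₂ ≤ ‖L‖₂ and ‖L₁‖∞ ≤ ‖L‖∞, and a complex k×n matrix R₁ with ‖R₁‖_c ≤ ‖R‖_c, ‖R₁‖₂ ≤ ‖R‖₂ and ‖R₁‖∞ ≤ ‖R‖∞, such that X = L₁*R₁ and the range (column space) of L₁ equals the range of R₁. -/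
open Matrix
open scoped ComplexOrder

noncomputable section

namespace MatFact

/-- ℓ² norm of a complex vector. -/
def vnorm {n : ℕ} (v : Fin n → ℂ) : ℝ := Real.sqrt (∑ j, ‖v j‖ ^ 2)

/-- Operator norm of a matrix as a map ℓ²(Fin n) → ℓ²(Fin m). -/
def opNorm {m n : ℕ} (X : Matrix (Fin m) (Fin n) ℂ) : ℝ :=
  sSup {c : ℝ | ∃ v : Fin n → ℂ, vnorm v ≤ 1 ∧ c = vnorm (X.mulVec v)}

/-- Column norm: the maximal ℓ² norm of a column. -/
def colNorm {m n : ℕ} (X : Matrix (Fin m) (Fin n) ℂ) : ℝ :=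
  ⨆ j : Fin n, vnorm (fun i => X i j)

/-- Hilbert–Schmidt (Frobenius) norm. -/
def frobNorm {m n : ℕ} (X : Matrix (Fin m) (Fin n) ℂ) : ℝ :=
  Real.sqrt (∑ i, ∑ j, ‖X i j‖ ^ 2)

/-- Schur norm: operator norm of Schur (entrywise) multiplication by `X`
on matrices with the operator norm. -/
def schurNorm {m n : ℕ} (X : Matrix (Fin m) (Fin n) ℂ) : ℝ :=
  sSup {c : ℝ | ∃ A : Matrix (Fin m) (Fin n) ℂ, opNorm A ≤ 1 ∧
    c = opNorm (Matrix.hadamard X A)}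

/-- The T-norm (bilinear Schur norm). -/
def Tnorm {m n : ℕ} (X : Matrix (Fin m) (Fin n) ℂ) : ℝ :=
  sSup {c : ℝ | ∃ (a : Fin m → ℂ) (B : Matrix (Fin m) (Fin n) ℂ),
    (∀ i, ‖a i‖ ≤ 1) ∧ opNorm B ≤ 1 ∧
    c = vnorm (fun j => ∑ i, a i * X i j * B i j)}

/-- The F-norm: operator norm of `X` from `ℂⁿ` with the sup norm to `ℂᵐ`
with the ℓ² norm. -/
def Fnorm {m n : ℕ} (X : Matrix (Fin m) (Fin n) ℂ) : ℝ :=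
  sSup {c : ℝ | ∃ v : Fin n → ℂ, (∀ j, ‖v j‖ ≤ 1) ∧ c = vnorm (X.mulVec v)}

/-- The bilinear form norm. -/
def Bnorm {m n : ℕ} (Y : Matrix (Fin m) (Fin n) ℂ) : ℝ :=
  sSup {c : ℝ | ∃ (a : Fin m → ℂ) (b : Fin n → ℂ), (∀ i, ‖a i‖ ≤ 1) ∧
    (∀ j, ‖b j‖ ≤ 1) ∧ c = ‖∑ i, ∑ j, Y i j * a i * b j‖}

/-- The completely bounded F-norm. -/
def cbF {m n : ℕ} (X : Matrix (Fin m) (Fin n) ℂ) : ℝ :=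
  sInf {c : ℝ | ∃ (A : Matrix (Fin m) (Fin n) ℂ) (ξ : Fin n → ℂ),
    X = A * Matrix.diagonal ξ ∧ c = opNorm A * vnorm ξ}

/-- The completely bounded bilinear form norm. -/
def cbB {m n : ℕ} (X : Matrix (Fin m) (Fin n) ℂ) : ℝ :=
  sInf {c : ℝ | ∃ (η : Fin m → ℂ) (B : Matrix (Fin m) (Fin n) ℂ) (ξ : Fin n → ℂ),
    X = Matrix.diagonal η * B * Matrix.diagonal ξ ∧
    c = vnorm η * opNorm B * vnorm ξ}

/-- The range (column space) of a matrix, as a submodule of `ℂᵐ`. -/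
def ran {m n : ℕ} (X : Matrix (Fin m) (Fin n) ℂ) : Submodule ℂ (Fin m → ℂ) :=
  LinearMap.range X.mulVecLin

/-- `P` is the orthogonal projection onto the subspace `E`, i.e. `P` is a
Hermitian idempotent with range `E`. -/
def IsOrthProjOnto {n : ℕ} (P : Matrix (Fin n) (Fin n) ℂ)
    (E : Submodule ℂ (Fin n → ℂ)) : Prop :=
  P.IsHermitian ∧ P * P = P ∧ ran P = E

/-- `W` is a partial isometry with support `E` and range `F`. -/
def IsPartialIsometryFromTo {m n : ℕ} (W : Matrix (Fin m) (Fin n) ℂ)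
    (E : Submodule ℂ (Fin n → ℂ)) (F : Submodule ℂ (Fin m → ℂ)) : Prop :=
  IsOrthProjOnto (Wᴴ * W) E ∧ IsOrthProjOnto (W * Wᴴ) F

/-- A cb operator factorization of `X`. -/
def IsCbOpFact {m n : ℕ} (X A : Matrix (Fin m) (Fin n) ℂ) (ξ : Fin n → ℂ) : Prop :=
  (∀ j, 0 ≤ ξ j) ∧ vnorm ξ = 1 ∧ opNorm A = cbF X ∧
  (∀ j, ξ j = 0 → ∀ i, A i j = 0) ∧ X = A * Matrix.diagonal ξ

/-- A cb bilinear form factorization of `X`. -/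
def IsCbBilFact {m n : ℕ} (X : Matrix (Fin m) (Fin n) ℂ) (η : Fin m → ℂ)
    (B : Matrix (Fin m) (Fin n) ℂ) (ξ : Fin n → ℂ) : Prop :=
  (∀ i, 0 ≤ η i) ∧ (∀ j, 0 ≤ ξ j) ∧ vnorm η = 1 ∧ vnorm ξ = 1 ∧
  opNorm B = cbB X ∧ (∀ j, ξ j = 0 → ∀ i, B i j = 0) ∧
  (∀ i, η i = 0 → ∀ j, B i j = 0) ∧ X = Matrix.diagonal η * B * Matrix.diagonal ξ

/-- A Schur factorization of `X`. -/
def IsSchurFact {m n : ℕ} (X : Matrix (Fin m) (Fin n) ℂ)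
    (F : Matrix (Fin m) (Fin m) ℂ) (W : Matrix (Fin m) (Fin n) ℂ)
    (G : Matrix (Fin n) (Fin n) ℂ) : Prop :=
  F.PosSemidef ∧ (∀ i, (F * F) i i ≤ 1) ∧ G.PosSemidef ∧ (∀ j, (G * G) j j ≤ 1) ∧
  IsPartialIsometryFromTo W (ran G) (ran F) ∧
  X = (schurNorm X : ℂ) • (F * W * G)

/-- A bilinear Schur factorization of `X`. -/
def IsBilinSchurFact {m n : ℕ} (X : Matrix (Fin m) (Fin n) ℂ)
    (T : Matrix (Fin m) (Fin m) ℂ) (W : Matrix (Fin m) (Fin n) ℂ)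
    (G : Matrix (Fin n) (Fin n) ℂ) : Prop :=
  T.PosSemidef ∧ frobNorm T = Tnorm X ∧ G.PosSemidef ∧ (∀ j, (G * G) j j ≤ 1) ∧
  IsPartialIsometryFromTo W (ran G) (ran T) ∧ X = T * W * G

/-- Maximal diagonal entry (real part) of a square matrix. -/
def maxDiag {n : ℕ} (P : Matrix (Fin n) (Fin n) ℂ) : ℝ := ⨆ i, (P i i).re

end MatFact

namespace MatFact

theorem vnorm_eq_norm {n : ℕ} (v : Fin n → ℂ) : vnorm v = ‖WithLp.toLp 2 v‖ := by
  rw [EuclideanSpace.norm_eq]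
  rfl

theorem exists_orthProj_matrix {k : ℕ} (E : Submodule ℂ (Fin k → ℂ)) :
    ∃ Q : Matrix (Fin k) (Fin k) ℂ, Qᴴ = Q ∧ (∀ v ∈ E, Q *ᵥ v = v) ∧
      (∀ v, Q *ᵥ v ∈ E) ∧ ∀ v, vnorm (Q *ᵥ v) ≤ vnorm v := by
  let F : Submodule ℂ (EuclideanSpace ℂ (Fin k)) :=
    E.comap (WithLp.linearEquiv 2 ℂ (Fin k → ℂ)).toLinearMap
  let Q : Matrix (Fin k) (Fin k) ℂ :=
    (Matrix.toEuclideanCLM (n := Fin k) (𝕜 := ℂ)).symm F.starProjection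
  have hQ : Matrix.toEuclideanCLM (𝕜 := ℂ) Q = F.starProjection :=
    StarAlgEquiv.apply_symm_apply _ _
  have hmul (v : Fin k → ℂ) : WithLp.toLp 2 (Q *ᵥ v) = F.starProjection (WithLp.toLp 2 v) := by
    rw [← hQ, Matrix.toEuclideanCLM_toLp]
  refine ⟨Q, ?_, fun v hv => ?_, fun v => ?_, fun v => ?_⟩
  · apply EquivLike.injective (Matrix.toEuclideanCLM (n := Fin k) (𝕜 := ℂ))
    rw [← Matrix.star_eq_conjTranspose, map_star, hQ]
    exact isSelfAdjoint_starProjection F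
  · apply WithLp.toLp_injective 2
    rw [hmul]
    exact Submodule.starProjection_eq_self_iff.mpr hv
  · have h : F.starProjection (WithLp.toLp 2 v) ∈ F := Submodule.starProjection_apply_mem F _
    rw [← hmul] at h
    exact h
  · rw [vnorm_eq_norm, vnorm_eq_norm, hmul]
    exact F.norm_starProjection_apply_le _

theorem colNorm_mul_le {k n : ℕ} {Q : Matrix (Fin k) (Fin k) ℂ}
    (hQ : ∀ v, vnorm (Q *ᵥ v) ≤ vnorm v) (A : Matrix (Fin k) (Fin n) ℂ) :
    colNorm (Q * A) ≤ colNorm A :=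
  ciSup_mono (Set.finite_range _).bddAbove fun j => hQ fun i => A i j

theorem frobNorm_mul_le {k n : ℕ} {Q : Matrix (Fin k) (Fin k) ℂ}
    (hQ : ∀ v, vnorm (Q *ᵥ v) ≤ vnorm v) (A : Matrix (Fin k) (Fin n) ℂ) :
    frobNorm (Q * A) ≤ frobNorm A := by
  unfold frobNorm
  rw [Finset.sum_comm, Finset.sum_comm (f := fun i j => ‖A i j‖ ^ 2)]
  refine Real.sqrt_le_sqrt (Finset.sum_le_sum fun j _ => ?_)
  exact (Real.sqrt_le_sqrt_iff (by positivity)).mp (hQ fun i => A i j)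

theorem bddAbove_vnorm_mulVec {k n : ℕ} (A : Matrix (Fin k) (Fin n) ℂ) :
    BddAbove {c : ℝ | ∃ v : Fin n → ℂ, vnorm v ≤ 1 ∧ c = vnorm (A.mulVec v)} := by
  let T := (Matrix.toEuclideanLin A).toContinuousLinearMap
  refine ⟨‖T‖, ?_⟩
  rintro c ⟨v, hv, rfl⟩
  rw [vnorm_eq_norm] at hv ⊢
  exact T.unit_le_opNorm _ hv

theorem opNorm_mul_le {k n : ℕ} {Q : Matrix (Fin k) (Fin k) ℂ}
    (hQ : ∀ v, vnorm (Q *ᵥ v) ≤ vnorm v) (A : Matrix (Fin k) (Fin n) ℂ) :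
    opNorm (Q * A) ≤ opNorm A := by
  refine csSup_le ⟨_, 0, by simp [vnorm], rfl⟩ ?_
  rintro c ⟨v, hv, rfl⟩
  rw [← Matrix.mulVec_mulVec]
  exact (hQ _).trans (le_csSup (bddAbove_vnorm_mulVec A) ⟨v, hv, rfl⟩)

theorem mul_eq_self_of_forall_mem_ran {k n : ℕ} {Q : Matrix (Fin k) (Fin k) ℂ}
    {A : Matrix (Fin k) (Fin n) ℂ} (hQ : ∀ v ∈ ran A, Q *ᵥ v = v) : Q * A = A := by
  refine Matrix.ext_of_mulVec_single fun j => ?_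
  rw [← Matrix.mulVec_mulVec]
  exact hQ _ ⟨_, rfl⟩

theorem stmt2 {m n k : ℕ} (X : Matrix (Fin m) (Fin n) ℂ)
    (L : Matrix (Fin k) (Fin m) ℂ) (R : Matrix (Fin k) (Fin n) ℂ)
    (hX : X = Lᴴ * R) :
    ∃ (L₁ : Matrix (Fin k) (Fin m) ℂ) (R₁ : Matrix (Fin k) (Fin n) ℂ),
      colNorm L₁ ≤ colNorm L ∧ frobNorm L₁ ≤ frobNorm L ∧ opNorm L₁ ≤ opNorm L ∧
      colNorm R₁ ≤ colNorm R ∧ frobNorm R₁ ≤ frobNorm R ∧ opNorm R₁ ≤ opNorm R ∧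
      X = L₁ᴴ * R₁ ∧ ran L₁ = ran R₁ := by
  obtain ⟨P, hP, hPfix, hPmem, hPnorm⟩ := exists_orthProj_matrix (ran L)
  obtain ⟨Q, hQ, hQfix, hQmem, hQnorm⟩ := exists_orthProj_matrix (ran (P * R))
  refine ⟨Q * L, P * R, colNorm_mul_le hQnorm L, frobNorm_mul_le hQnorm L,
    opNorm_mul_le hQnorm L, colNorm_mul_le hPnorm R, frobNorm_mul_le hPnorm R,
    opNorm_mul_le hPnorm R, ?_, le_antisymm ?_ ?_⟩
  · have hPL : Lᴴ * P = Lᴴ := by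
      simpa [hP] using congrArg conjTranspose (mul_eq_self_of_forall_mem_ran hPfix)
    rw [conjTranspose_mul, hQ, Matrix.mul_assoc, mul_eq_self_of_forall_mem_ran hQfix,
      ← Matrix.mul_assoc, hPL, hX]
  · rintro _ ⟨v, rfl⟩
    rw [Matrix.mulVecLin_apply, ← Matrix.mulVec_mulVec]
    exact hQmem _
  · intro w hw
    have hwL : w ∈ ran L := by
      obtain ⟨v, rfl⟩ := hw
      rw [Matrix.mulVecLin_apply, ← Matrix.mulVec_mulVec]
      exact hPmem _
    obtain ⟨u, rfl⟩ := hwL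
    refine ⟨u, ?_⟩
    rw [Matrix.mulVecLin_apply, ← Matrix.mulVec_mulVec]
    exact hQfix _ hw

end MatFact
end
end

section
/- Let X be a complex m×n matrix and suppose X = F C G where F is a positive semidefinite m×m matrix, C is a complex m×n matrix and G is a positive semidefinite n×n matrix. Then ‖X‖_S ≤ (max diagonal entry of F²)^{1/2} · ‖C‖∞ · (max diagonal entry of G²)^{1/2}. -/
open Matrix
open scoped ComplexOrder

noncomputable section

namespace MatFact

theorem vnorm_nonneg {n : ℕ} (v : Fin n → ℂ) : 0 ≤ vnorm v := Real.sqrt_nonneg _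

theorem vnorm_sq {n : ℕ} (v : Fin n → ℂ) : vnorm v ^ 2 = ∑ j, ‖v j‖ ^ 2 :=
  Real.sq_sqrt (by positivity)

theorem vnorm_smul {n : ℕ} (c : ℂ) (v : Fin n → ℂ) : vnorm (c • v) = ‖c‖ * vnorm v := by
  simp only [vnorm, Pi.smul_apply, smul_eq_mul, norm_mul, mul_pow, ← Finset.mul_sum]
  rw [Real.sqrt_mul (by positivity), Real.sqrt_sq (norm_nonneg c)]

/-- The Cauchy–Schwarz inequality for a bilinear sum of complex numbers. -/
theorem norm_sum_mul_sq_le {n : ℕ} (a b : Fin n → ℂ) :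
    ‖∑ k, a k * b k‖ ^ 2 ≤ (∑ k, ‖a k‖ ^ 2) * ∑ k, ‖b k‖ ^ 2 := by
  calc ‖∑ k, a k * b k‖ ^ 2 ≤ (∑ k, ‖a k‖ * ‖b k‖) ^ 2 := by
        gcongr
        exact (norm_sum_le _ _).trans_eq (by simp)
    _ ≤ _ := Finset.sum_mul_sq_le_sq_mul_sq _ _ _

theorem vnorm_mulVec_le_frobNorm {m n : ℕ} (X : Matrix (Fin m) (Fin n) ℂ) (v : Fin n → ℂ) :
    vnorm (X.mulVec v) ≤ frobNorm X * vnorm v := by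
  rw [vnorm, frobNorm, vnorm, ← Real.sqrt_mul (by positivity), Finset.sum_mul]
  exact Real.sqrt_le_sqrt (Finset.sum_le_sum fun i _ => norm_sum_mul_sq_le (X i) v)

theorem opNorm_nonneg {m n : ℕ} (X : Matrix (Fin m) (Fin n) ℂ) : 0 ≤ opNorm X := by
  refine Real.sSup_nonneg ?_
  rintro _ ⟨v, -, rfl⟩
  exact vnorm_nonneg _

theorem vnorm_mulVec_le_opNorm {m n : ℕ} (X : Matrix (Fin m) (Fin n) ℂ) {v : Fin n → ℂ}
    (hv : vnorm v ≤ 1) : vnorm (X.mulVec v) ≤ opNorm X := by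
  refine le_csSup ⟨frobNorm X, ?_⟩ ⟨v, hv, rfl⟩
  rintro _ ⟨w, hw, rfl⟩
  exact (vnorm_mulVec_le_frobNorm X w).trans
    (mul_le_of_le_one_right (Real.sqrt_nonneg _) hw)

theorem vnorm_mulVec_le {m n : ℕ} (X : Matrix (Fin m) (Fin n) ℂ) (v : Fin n → ℂ) :
    vnorm (X.mulVec v) ≤ opNorm X * vnorm v := by
  rcases (vnorm_nonneg v).eq_or_lt with h | h
  · simpa [← h] using vnorm_mulVec_le_frobNorm X v
  · have key := vnorm_mulVec_le_opNorm X (v := ((vnorm v : ℂ)⁻¹) • v) (by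
      rw [vnorm_smul, norm_inv, Complex.norm_of_nonneg h.le, inv_mul_cancel₀ h.ne'])
    rw [Matrix.mulVec_smul, vnorm_smul, norm_inv, Complex.norm_of_nonneg h.le,
      inv_mul_le_iff₀ h] at key
    linarith

theorem sum_norm_mulVec_sq_le {m n : ℕ} (X : Matrix (Fin m) (Fin n) ℂ) (v : Fin n → ℂ) :
    ∑ i, ‖X.mulVec v i‖ ^ 2 ≤ opNorm X ^ 2 * ∑ j, ‖v j‖ ^ 2 := by
  rw [← vnorm_sq, ← vnorm_sq, ← mul_pow]
  exact pow_le_pow_left₀ (vnorm_nonneg _) (vnorm_mulVec_le X v) 2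

theorem _root_.Matrix.IsHermitian.mul_self_apply_self_re {n : ℕ}
    {P : Matrix (Fin n) (Fin n) ℂ} (hP : P.IsHermitian) (i : Fin n) :
    ((P * P) i i).re = ∑ k, ‖P i k‖ ^ 2 := by
  rw [Matrix.mul_apply, Complex.re_sum]
  refine Finset.sum_congr rfl fun k _ => ?_
  rw [← hP.apply k i, Complex.star_def, Complex.mul_conj, Complex.ofReal_re,
    Complex.normSq_eq_norm_sq]

theorem sum_norm_row_sq_le_maxDiag {n : ℕ} {P : Matrix (Fin n) (Fin n) ℂ}
    (hP : P.IsHermitian) (i : Fin n) : ∑ k, ‖P i k‖ ^ 2 ≤ maxDiag (P * P) := by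
  rw [← hP.mul_self_apply_self_re]
  exact le_ciSup (f := fun i => ((P * P) i i).re) (Set.finite_range _).bddAbove i

theorem sum_norm_col_sq_le_maxDiag {n : ℕ} {P : Matrix (Fin n) (Fin n) ℂ}
    (hP : P.IsHermitian) (j : Fin n) : ∑ k, ‖P k j‖ ^ 2 ≤ maxDiag (P * P) := by
  refine le_trans (Finset.sum_le_sum fun k _ => ?_) (sum_norm_row_sq_le_maxDiag hP j)
  rw [← hP.apply k j, norm_star]

theorem maxDiag_mul_self_nonneg {n : ℕ} {P : Matrix (Fin n) (Fin n) ℂ}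
    (hP : P.IsHermitian) : 0 ≤ maxDiag (P * P) :=
  Real.iSup_nonneg fun i => by
    rw [hP.mul_self_apply_self_re]
    positivity

theorem hadamard_mul_mul_mulVec {m n : ℕ} (F : Matrix (Fin m) (Fin m) ℂ)
    (C : Matrix (Fin m) (Fin n) ℂ) (G : Matrix (Fin n) (Fin n) ℂ)
    (A : Matrix (Fin m) (Fin n) ℂ) (v : Fin n → ℂ) (i : Fin m) :
    (Matrix.hadamard (F * C * G) A).mulVec v i =
      ∑ k, F i k * C.mulVec (fun l => A.mulVec (fun j => G l j * v j) i) k := by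
  simp only [Matrix.mul_assoc F, Matrix.mulVec, dotProduct, Matrix.hadamard_apply,
    Matrix.mul_apply, Finset.mul_sum, Finset.sum_mul]
  rw [Finset.sum_comm]
  refine Finset.sum_congr rfl fun k _ => ?_
  rw [Finset.sum_comm]
  refine Finset.sum_congr rfl fun l _ => Finset.sum_congr rfl fun j _ => ?_
  ring

theorem sum_norm_hadamard_mulVec_sq_le {m n : ℕ} {F : Matrix (Fin m) (Fin m) ℂ}
    (C : Matrix (Fin m) (Fin n) ℂ) {G : Matrix (Fin n) (Fin n) ℂ}
    (hF : F.IsHermitian) (hG : G.IsHermitian)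
    (A : Matrix (Fin m) (Fin n) ℂ) (v : Fin n → ℂ) :
    ∑ i, ‖(Matrix.hadamard (F * C * G) A).mulVec v i‖ ^ 2 ≤
      maxDiag (F * F) * (opNorm C ^ 2 *
        (opNorm A ^ 2 * (maxDiag (G * G) * ∑ j, ‖v j‖ ^ 2))) := by
  have hF0 := maxDiag_mul_self_nonneg hF
  calc ∑ i, ‖(Matrix.hadamard (F * C * G) A).mulVec v i‖ ^ 2
      ≤ ∑ i, maxDiag (F * F) * (opNorm C ^ 2 *
          ∑ l, ‖A.mulVec (fun j => G l j * v j) i‖ ^ 2) := by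
        refine Finset.sum_le_sum fun i _ => ?_
        rw [hadamard_mul_mul_mulVec]
        refine (norm_sum_mul_sq_le _ _).trans ?_
        gcongr
        · exact sum_norm_row_sq_le_maxDiag hF i
        · exact sum_norm_mulVec_sq_le C _
    _ = maxDiag (F * F) * (opNorm C ^ 2 *
          ∑ l, ∑ i, ‖A.mulVec (fun j => G l j * v j) i‖ ^ 2) := by
        rw [← Finset.mul_sum, ← Finset.mul_sum, Finset.sum_comm]
    _ ≤ maxDiag (F * F) * (opNorm C ^ 2 *
          ∑ l, opNorm A ^ 2 * ∑ j, ‖G l j * v j‖ ^ 2) := by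
        gcongr
        exact sum_norm_mulVec_sq_le A _
    _ = maxDiag (F * F) * (opNorm C ^ 2 *
          (opNorm A ^ 2 * ∑ j, (∑ l, ‖G l j‖ ^ 2) * ‖v j‖ ^ 2)) := by
        rw [← Finset.mul_sum, Finset.sum_comm]
        simp only [norm_mul, mul_pow, Finset.sum_mul]
    _ ≤ _ := by
        rw [Finset.mul_sum (a := maxDiag (G * G))]
        gcongr
        exact sum_norm_col_sq_le_maxDiag hG _

theorem stmt9 {m n : ℕ} (X C : Matrix (Fin m) (Fin n) ℂ)
    (F : Matrix (Fin m) (Fin m) ℂ) (G : Matrix (Fin n) (Fin n) ℂ)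
    (hF : F.PosSemidef) (hG : G.PosSemidef) (hX : X = F * C * G) :
    schurNorm X ≤
      Real.sqrt (maxDiag (F * F)) * opNorm C * Real.sqrt (maxDiag (G * G)) := by
  have hF0 := maxDiag_mul_self_nonneg hF.isHermitian
  have hG0 := maxDiag_mul_self_nonneg hG.isHermitian
  have hC0 := opNorm_nonneg C
  have hB : 0 ≤ Real.sqrt (maxDiag (F * F)) * opNorm C * Real.sqrt (maxDiag (G * G)) := by
    positivity
  refine Real.sSup_le ?_ hB
  rintro _ ⟨A, hA, rfl⟩
  refine Real.sSup_le ?_ hB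
  rintro _ ⟨v, hv, rfl⟩
  have hA2 : opNorm A ^ 2 ≤ 1 := pow_le_one₀ (opNorm_nonneg A) hA
  have hv2 : vnorm v ^ 2 ≤ 1 := pow_le_one₀ (vnorm_nonneg v) hv
  refine (sq_le_sq₀ (vnorm_nonneg _) hB).1 ?_
  rw [mul_pow, mul_pow, Real.sq_sqrt hF0, Real.sq_sqrt hG0, vnorm_sq, hX]
  calc _ ≤ maxDiag (F * F) * (opNorm C ^ 2 *
        (opNorm A ^ 2 * (maxDiag (G * G) * vnorm v ^ 2))) := by
        rw [vnorm_sq]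
        exact sum_norm_hadamard_mulVec_sq_le C hF.isHermitian hG.isHermitian A v
    _ ≤ maxDiag (F * F) * (opNorm C ^ 2 * (1 * (maxDiag (G * G) * 1))) := by gcongr
    _ = _ := by ring

end MatFact
end
end
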